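/- Riesz–Kolmogorov criterion in operator form: let X = ℝⁿ, H = L²(X), U_x translation and V_k multiplication by the character e^{i⟨·,k⟩}. A bounded operator T on H is compact if and only if lim_{k→0} ‖(V_k − 1)T‖ = 0 and lim_{x→0} ‖(U_x − 1)T‖ = 0. -/

import Mathlib

open Filter Topology MeasureTheory ContinuousLinearMap
open scoped RealInnerProductSpace


namespace RK
open scoped ENNReal

lemma tendsto_of_compact {X H G : Type*} [NormedAddCommGroup H] [NormedSpace ℂ H]
    [NormedAddCommGroup G] [NormedSpace ℂ G] {l : Filter X}
    (W : X → (H →L[ℂ] G)) (C : ℝ) (hC : ∀ x, ‖W x‖ ≤ C)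
    (hW : ∀ g, Tendsto (fun x => W x g) l (𝓝 0)) (T : H →L[ℂ] H) (hT : IsCompactOperator T) :
    Tendsto (fun x => ‖W x ∘L T‖) l (𝓝 0) := by
  obtain ⟨K, hK, hKT⟩ := IsCompactOperator.image_closedBall_subset_compact
    (f := (T : H →ₗ[ℂ] H)) hT 1
  rw [Metric.tendsto_nhds]
  intro ε hε
  have hC' : 0 < |C| + 1 := by positivity
  obtain ⟨t, htf, ht⟩ := Metric.totallyBounded_iff.1 hK.totallyBounded (ε / 4 / (|C| + 1)) (by positivity)
  have hev : ∀ᶠ x in l, ∀ y ∈ t, ‖W x y‖ < ε / 4 := by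
    rw [Filter.eventually_all_finite htf]
    intro y _
    have := (Metric.tendsto_nhds.1 (hW y)) (ε / 4) (by positivity)
    simpa using this
  filter_upwards [hev] with x hx
  have : ‖W x ∘L T‖ ≤ ε / 2 := by
    refine ContinuousLinearMap.opNorm_le_of_unit_norm (𝕜 := ℂ) (by positivity) ?_
    intro v hv
    have h1 : T v ∈ K := hKT ⟨v, by simp [hv], rfl⟩
    obtain ⟨y, hy, hvy⟩ := Set.mem_iUnion₂.1 (ht h1)
    rw [Metric.mem_ball, dist_eq_norm] at hvy
    have h2 : (W x ∘L T) v = W x (T v - y) + W x y := by simp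
    rw [h2]
    have h3 : ‖W x (T v - y)‖ ≤ (|C| + 1) * (ε / 4 / (|C| + 1)) := by
      refine (le_opNorm _ _).trans ?_
      have := hC x
      have := le_abs_self C
      gcongr
      linarith
    have h4 : (|C| + 1) * (ε / 4 / (|C| + 1)) = ε / 4 := by field_simp
    have := norm_add_le (W x (T v - y)) (W x y)
    have := hx y hy
    linarith
  simp only [dist_zero_right, norm_norm]
  linarith

section HS
variable {X H : Type*} [MeasurableSpace X] {μ : Measure X} [NormedAddCommGroup H] [NormedSpace ℂ H]

/-- The Hilbert-Schmidt type operator `f ↦ (y ↦ Ψ y f)`. -/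
noncomputable def K : Lp (H →L[ℂ] ℂ) 2 μ →L[ℂ] (H →L[ℂ] Lp ℂ 2 μ) :=
  LinearMap.mkContinuous₂
    (LinearMap.mk₂ ℂ (fun (Ψ : Lp (H →L[ℂ] ℂ) 2 μ) (f : H) =>
      (ContinuousLinearMap.apply ℂ ℂ f).compLpL 2 μ Ψ)
      (fun _ _ _ => map_add _ _ _)
      (fun _ _ _ => map_smul _ _ _)
      (fun Ψ f g => by simp only [map_add, add_compLpL]; rfl)
      (fun c Ψ f => by rw [map_smul, smul_compLpL]; rfl))
    1 (by
      intro Ψ f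
      rw [one_mul, mul_comm]
      apply Lp.norm_le_mul_norm_of_ae_le_mul
      simp only [LinearMap.mk₂_apply]
      filter_upwards [coeFn_compLpL (p := 2) (μ := μ) (ContinuousLinearMap.apply ℂ ℂ f) Ψ] with y hy
      rw [hy, mul_comm]
      exact le_opNorm (Ψ y) f)

lemma K_apply (Ψ : Lp (H →L[ℂ] ℂ) 2 μ) (f : H) : (K Ψ f : X → ℂ) =ᵐ[μ] fun y => Ψ y f := 
  coeFn_compLpL (p := 2) (μ := μ) (ContinuousLinearMap.apply ℂ ℂ f) Ψ

lemma K_compact (Ψ : Lp (H →L[ℂ] ℂ) 2 μ) : IsCompactOperator (K Ψ) := by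
  refine Lp.induction (p := 2) (by norm_num) (motive := fun Ψ => IsCompactOperator (K Ψ))
    ?_ ?_ ?_ Ψ
  · intro c s hs hμs
    have : K (Lp.simpleFunc.indicatorConst 2 hs hμs.ne c : Lp (H →L[ℂ] ℂ) 2 μ)
        = (ContinuousLinearMap.toSpanSingleton ℂ (indicatorConstLp 2 hs hμs.ne (1:ℂ))) ∘L c := by
      ext1 f
      apply Lp.ext
      refine (K_apply _ f).trans ?_
      rw [Lp.simpleFunc.coe_indicatorConst]
      simp only [coe_comp, Function.comp_apply, toSpanSingleton_apply]
      filter_upwards [Lp.coeFn_smul (c f) (indicatorConstLp 2 hs hμs.ne (1:ℂ)),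
        indicatorConstLp_coeFn (p := 2) (hs := hs) (hμs := hμs.ne) (c := (1:ℂ)),
        indicatorConstLp_coeFn (p := 2) (hs := hs) (hμs := hμs.ne) (c := c)] with y h1 h2 h3
      rw [h1, h3, Pi.smul_apply, h2]
      by_cases hy : y ∈ s <;> simp [hy]
    rw [this]
    have hc : IsCompactOperator c :=
      (isCompactOperator_id (E := ℂ)).comp_clm c
    exact hc.clm_comp (toSpanSingleton ℂ (indicatorConstLp 2 hs hμs.ne (1:ℂ)))
  · intro f g hf hg _ h1 h2
    simp only [map_add]
    exact h1.add h2
  · exact isClosed_setOfPred_isCompactOperator.preimage K.continuous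
end HS

section L2
variable {X : Type*} [MeasurableSpace X] {μ : Measure X} 
lemma enorm_sq (f : Lp ℂ 2 μ) : ‖f‖ₑ ^ 2 = ∫⁻ y, ‖f y‖ₑ ^ 2 ∂μ := by
  have := eLpNorm_nnreal_pow_eq_lintegral (f := f) (μ := μ) (p := 2) (by norm_num)
  rw [Lp.enorm_def]
  simpa using this

lemma lintegral_sq_le (g : X → ℝ≥0∞) (hg : AEMeasurable g μ) :
    (∫⁻ y, g y ∂μ) ^ 2 ≤ μ Set.univ * ∫⁻ y, g y ^ 2 ∂μ := by
  have := ENNReal.lintegral_mul_le_Lp_mul_Lq μ (p := 2) (q := 2) (by constructor <;> norm_num)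
    (f := fun _ => 1) (g := g) (by fun_prop) hg
  simp only [Pi.mul_apply, one_mul, ENNReal.one_rpow, lintegral_const] at this
  have h2 := pow_le_pow_left' this 2
  rw [mul_pow, ← ENNReal.rpow_natCast, ← ENNReal.rpow_natCast,← ENNReal.rpow_natCast, ← ENNReal.rpow_mul, ← ENNReal.rpow_mul] at h2
  simpa using h2
end L2

lemma norm_exp_sub_one_sq (θ : ℝ) : ‖Complex.exp (Complex.I * θ) - 1‖ ^ 2 = 2 - 2 * Real.cos θ := by
  rw [mul_comm, Complex.exp_mul_I, ← Complex.ofReal_cos, ← Complex.ofReal_sin, ← Complex.normSq_eq_norm_sq,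
    Complex.normSq_apply]
  simp only [Complex.add_re, Complex.sub_re, Complex.sub_im, Complex.add_im, Complex.mul_re, Complex.mul_im,
    Complex.ofReal_re, Complex.ofReal_im, Complex.I_re, Complex.I_im, Complex.one_re, Complex.one_im]
  nlinarith [Real.sin_sq_add_cos_sq θ]

lemma inner_bound (a δ : ℝ) (hδ : 0 < δ) (ha : 2 / δ ≤ |a|) :
    ENNReal.ofReal δ ≤ ∫⁻ t in Set.Ioc 0 δ, ‖Complex.exp (Complex.I * ((t * a : ℝ) : ℂ)) - 1‖ₑ ^ 2 := by
  have h2 : 0 < 2 / δ := by positivity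
  have ha0 : a ≠ 0 := by rintro rfl; simp at ha; linarith
  have h1 : ∀ t : ℝ, ‖Complex.exp (Complex.I * ((t * a : ℝ) : ℂ)) - 1‖ₑ ^ 2
      = ENNReal.ofReal (2 - 2 * Real.cos (t * a)) := by
    intro t
    rw [← norm_exp_sub_one_sq, ENNReal.ofReal_pow (norm_nonneg _), ofReal_norm]
  simp_rw [h1]
  rw [← ofReal_integral_eq_lintegral_ofReal]
  · apply ENNReal.ofReal_le_ofReal
    rw [← intervalIntegral.integral_of_le hδ.le, intervalIntegral.integral_sub (by simp)
      (Continuous.intervalIntegrable (by fun_prop) _ _), intervalIntegral.integral_const_mul,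
      intervalIntegral.integral_comp_mul_right _ ha0, integral_cos]
    simp only [intervalIntegral.integral_const, smul_eq_mul, zero_mul, Real.sin_zero, sub_zero]
    have h3 : a⁻¹ * Real.sin (δ * a) ≤ δ / 2 := by
      refine (le_abs_self _).trans ?_
      rw [abs_mul, abs_inv]
      calc |a|⁻¹ * |Real.sin (δ * a)| ≤ (2 / δ)⁻¹ * 1 := by
            gcongr
            exact Real.abs_sin_le_one _
        _ = δ / 2 := by simp
    linarith
  · exact (Continuous.integrableOn_Ioc (by fun_prop))
  · refine Eventually.of_forall fun t => ?_
    have := Real.cos_le_one (t * a)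
    simp only [Pi.zero_apply]; linarith

variable {n : ℕ} {μ : Measure (EuclideanSpace ℝ (Fin n))} [μ.IsAddHaarMeasure]

lemma tail (f : Lp ℂ 2 μ) (e : EuclideanSpace ℝ (Fin n)) (δ : ℝ) (hδ : 0 < δ) (M : ℝ≥0∞)
    (h : ∀ t ∈ Set.Ioc 0 δ, ∫⁻ y, ‖(Complex.exp (Complex.I * (⟪y, t • e⟫ : ℝ)) - 1) * f y‖ₑ ^ 2 ∂μ ≤ M) :
    ∫⁻ y in {y | 2 / δ ≤ |⟪y, e⟫|}, ‖f y‖ₑ ^ 2 ∂μ ≤ M := by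
  have hf := (Lp.stronglyMeasurable f).measurable
  have hb : ENNReal.ofReal δ ≠ 0 := by simpa using hδ
  have key : ENNReal.ofReal δ * ∫⁻ y in {y | 2 / δ ≤ |⟪y, e⟫|}, ‖f y‖ₑ ^ 2 ∂μ ≤ ENNReal.ofReal δ * M := by
    calc ENNReal.ofReal δ * ∫⁻ y in {y | 2 / δ ≤ |⟪y, e⟫|}, ‖f y‖ₑ ^ 2 ∂μ
        = ∫⁻ y in {y | 2 / δ ≤ |⟪y, e⟫|}, ENNReal.ofReal δ * ‖f y‖ₑ ^ 2 ∂μ := by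
          rw [lintegral_const_mul _ (by fun_prop)]
      _ ≤ ∫⁻ y in {y | 2 / δ ≤ |⟪y, e⟫|}, ∫⁻ t in Set.Ioc 0 δ,
            ‖(Complex.exp (Complex.I * (⟪y, t • e⟫ : ℝ)) - 1) * f y‖ₑ ^ 2 ∂volume ∂μ := by
          refine setLIntegral_mono' (measurableSet_le (by fun_prop) (by fun_prop)) ?_
          intro y hy
          simp_rw [enorm_mul, mul_pow, inner_smul_right]
          rw [lintegral_mul_const _ (by fun_prop)]
          gcongr
          exact inner_bound _ δ hδ hy
      _ ≤ ∫⁻ y, ∫⁻ t in Set.Ioc 0 δ,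
            ‖(Complex.exp (Complex.I * (⟪y, t • e⟫ : ℝ)) - 1) * f y‖ₑ ^ 2 ∂volume ∂μ := setLIntegral_le_lintegral _ _
      _ = ∫⁻ t in Set.Ioc 0 δ, ∫⁻ y, 
            ‖(Complex.exp (Complex.I * (⟪y, t • e⟫ : ℝ)) - 1) * f y‖ₑ ^ 2 ∂μ := by
          rw [lintegral_lintegral_swap]
          refine Measurable.aemeasurable ?_
          simp only [Function.uncurry_def]
          fun_prop
      _ ≤ ∫⁻ t in Set.Ioc 0 δ, M := setLIntegral_mono' measurableSet_Ioc h
      _ = ENNReal.ofReal δ * M := by simp [mul_comm]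
  exact (ENNReal.mul_le_mul_iff_right hb (by simp)).1 key

lemma average (f : Lp ℂ 2 μ) (δ : ℝ) (hδ : 0 < δ) (M : ℝ≥0∞)
    (h : ∀ x ∈ Metric.ball 0 δ, ∫⁻ y, ‖f y - f (x + y)‖ₑ ^ 2 ∂μ ≤ M) :
    ∫⁻ y, ‖f y - ((μ.real (Metric.ball 0 δ))⁻¹ : ℝ) • ∫ x in Metric.ball 0 δ, f (x + y) ∂μ‖ₑ ^ 2 ∂μ ≤ M := by
  have hf := (Lp.stronglyMeasurable f).measurable
  set B := Metric.ball (0 : EuclideanSpace ℝ (Fin n)) δ with hB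
  have hb0 : μ B ≠ 0 := (Metric.measure_ball_pos μ 0 hδ).ne'
  have hbt : μ B ≠ ∞ := measure_ball_lt_top.ne
  have hbr : μ.real B ≠ 0 := by simp [measureReal_def, ENNReal.toReal_eq_zero_iff, hb0, hbt]
  have hfin : IsFiniteMeasure (μ.restrict B) := ⟨by simpa using hbt.lt_top⟩
  have hint : ∀ y, IntegrableOn (fun x => f (x + y)) B μ := by
    intro y
    have h1 : MemLp (fun x => f (x + y)) 2 μ :=
      (Lp.memLp f).comp_measurePreserving (measurePreserving_add_right μ y)
    exact (h1.restrict B).integrable (by norm_num)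
  have hpt : ∀ y, ‖f y - ((μ.real B)⁻¹ : ℝ) • ∫ x in B, f (x + y) ∂μ‖ₑ ^ 2
      ≤ (μ B)⁻¹ * ∫⁻ x in B, ‖f y - f (x + y)‖ₑ ^ 2 ∂μ := by
    intro y
    have h1 : f y - ((μ.real B)⁻¹ : ℝ) • ∫ x in B, f (x + y) ∂μ
        = ((μ.real B)⁻¹ : ℝ) • ∫ x in B, (f y - f (x + y)) ∂μ := by
      rw [integral_sub (by simp) (hint y)]
      simp only [integral_const, smul_sub, smul_smul, measureReal_restrict_apply_univ]
      rw [inv_mul_cancel₀ hbr, one_smul]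
    have h2 : ‖((μ.real B)⁻¹ : ℝ)‖ₑ = (μ B)⁻¹ := by
      rw [enorm_inv hbr, Real.enorm_of_nonneg measureReal_nonneg, measureReal_def, ENNReal.ofReal_toReal hbt]
    rw [h1, enorm_smul, h2, mul_pow]
    calc (μ B)⁻¹ ^ 2 * ‖∫ x in B, (f y - f (x + y)) ∂μ‖ₑ ^ 2
        ≤ (μ B)⁻¹ ^ 2 * (∫⁻ x in B, ‖f y - f (x + y)‖ₑ ∂μ) ^ 2 := by
          gcongr
          exact enorm_integral_le_lintegral_enorm _
      _ ≤ (μ B)⁻¹ ^ 2 * (μ B * ∫⁻ x in B, ‖f y - f (x + y)‖ₑ ^ 2 ∂μ) := by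
          gcongr
          refine (lintegral_sq_le _ (by fun_prop)).trans ?_
          simp
      _ = _ := by
          rw [← mul_assoc, sq, mul_assoc (μ B)⁻¹, ENNReal.inv_mul_cancel hb0 hbt, mul_one]
  calc _ ≤ ∫⁻ y, (μ B)⁻¹ * ∫⁻ x in B, ‖f y - f (x + y)‖ₑ ^ 2 ∂μ ∂μ := lintegral_mono hpt
    _ = (μ B)⁻¹ * ∫⁻ y, ∫⁻ x in B, ‖f y - f (x + y)‖ₑ ^ 2 ∂μ ∂μ := by
        rw [lintegral_const_mul' _ _ (by simp [hb0])]
    _ = (μ B)⁻¹ * ∫⁻ x in B, ∫⁻ y, ‖f y - f (x + y)‖ₑ ^ 2 ∂μ ∂μ := by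
        rw [lintegral_lintegral_swap]
        refine Measurable.aemeasurable ?_
        simp only [Function.uncurry_def]
        fun_prop
    _ ≤ (μ B)⁻¹ * ∫⁻ x in B, M ∂μ := by
        exact mul_le_mul_right (setLIntegral_mono' measurableSet_ball h) _
    _ = M := by
        simp only [lintegral_const, Measure.restrict_apply_univ]
        rw [mul_comm M, ← mul_assoc, ENNReal.inv_mul_cancel hb0 hbt, one_mul]

/-- The averaging functional. -/
noncomputable def Psi (μ : Measure (EuclideanSpace ℝ (Fin n))) [μ.IsAddHaarMeasure] (δ : ℝ) (y : EuclideanSpace ℝ (Fin n)) : Lp ℂ 2 μ →L[ℂ] ℂ :=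
  (((μ.real (Metric.ball 0 δ))⁻¹ : ℝ) : ℂ) • innerSL ℂ (DomAddAct.mk (-y) +ᵥ
    (indicatorConstLp 2 measurableSet_ball (measure_ball_lt_top (μ := μ) (x := (0 : EuclideanSpace ℝ (Fin n))) (r := δ)).ne (1:ℂ)))

lemma Psi_cont (δ : ℝ) : Continuous (Psi μ δ) := by
  unfold Psi
  have h : Continuous fun y : EuclideanSpace ℝ (Fin n) => (DomAddAct.mk (-y)) := 
    (DomAddAct.continuous_mk).comp continuous_neg
  have : Fact ((2 : ℝ≥0∞) ≠ ∞) := ⟨by norm_num⟩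
  have h2 := h.vadd (continuous_const (y := (indicatorConstLp 2 measurableSet_ball (measure_ball_lt_top (μ := μ) (x := (0 : EuclideanSpace ℝ (Fin n))) (r := δ)).ne (1:ℂ))))
  exact (((innerSL ℂ).continuous).comp h2).const_smul (((μ.real (Metric.ball 0 δ))⁻¹ : ℝ) : ℂ)

lemma Psi_norm (δ : ℝ) : ∃ C, ∀ y, ‖Psi μ δ y‖ ≤ C := by
  refine ⟨‖(((μ.real (Metric.ball (0 : EuclideanSpace ℝ (Fin n)) δ))⁻¹ : ℝ) : ℂ)‖ * ‖(indicatorConstLp 2 measurableSet_ball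
    (measure_ball_lt_top (μ := μ) (x := (0 : EuclideanSpace ℝ (Fin n))) (r := δ)).ne (1:ℂ))‖, fun y => ?_⟩
  unfold Psi
  rw [norm_smul, innerSL_apply_norm, DomAddAct.norm_vadd_Lp]

lemma Psi_apply (δ : ℝ) (y : EuclideanSpace ℝ (Fin n)) (f : Lp ℂ 2 μ) :
    Psi μ δ y f = ((μ.real (Metric.ball 0 δ))⁻¹ : ℝ) • ∫ x in Metric.ball 0 δ, f (x + y) ∂μ := by
  unfold Psi
  rw [DomAddAct.mk_vadd_indicatorConstLp]
  simp only [_root_.smul_apply, innerSL_apply_apply]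
  rw [L2.inner_indicatorConstLp_one]
  rw [smul_eq_mul, Complex.real_smul]
  congr 1
  have := (measurePreserving_add_left μ (-y)).setIntegral_preimage_emb
    (MeasurableEquiv.addLeft (-y)).measurableEmbedding (fun x => f (x + y)) (Metric.ball 0 δ)
  rw [← this]
  simp

lemma diffV {V : EuclideanSpace ℝ (Fin n) → (Lp ℂ 2 μ →L[ℂ] Lp ℂ 2 μ)}
    (hV : ∀ (k : EuclideanSpace ℝ (Fin n)) (f : Lp ℂ 2 μ),
      (V k f : EuclideanSpace ℝ (Fin n) → ℂ) =ᵐ[μ]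
        fun y => Complex.exp (Complex.I * (⟪y, k⟫ : ℝ)) * f y)
    (k : EuclideanSpace ℝ (Fin n)) (f : Lp ℂ 2 μ) :
    ‖(V k - 1) f‖ₑ ^ 2 = ∫⁻ y, ‖(Complex.exp (Complex.I * (⟪y, k⟫ : ℝ)) - 1) * f y‖ₑ ^ 2 ∂μ := by
  rw [enorm_sq]
  apply lintegral_congr_ae
  have h0 : (V k - 1) f = V k f - f := rfl
  rw [h0]
  filter_upwards [hV k f, Lp.coeFn_sub (V k f) f] with y h1 h2
  rw [h2, Pi.sub_apply, h1, sub_mul, one_mul]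

lemma diffU {U : EuclideanSpace ℝ (Fin n) → (Lp ℂ 2 μ →L[ℂ] Lp ℂ 2 μ)}
    (hU : ∀ (x : EuclideanSpace ℝ (Fin n)) (f : Lp ℂ 2 μ),
      (U x f : EuclideanSpace ℝ (Fin n) → ℂ) =ᵐ[μ] fun y => f (x + y))
    (x : EuclideanSpace ℝ (Fin n)) (f : Lp ℂ 2 μ) :
    ‖(U x - 1) f‖ₑ ^ 2 = ∫⁻ y, ‖f y - f (x + y)‖ₑ ^ 2 ∂μ := by
  rw [enorm_sq]
  apply lintegral_congr_ae
  have h0 : (U x - 1) f = U x f - f := rfl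
  rw [h0]
  filter_upwards [hU x f, Lp.coeFn_sub (U x f) f] with y h1 h2
  rw [h2, Pi.sub_apply, h1, ← enorm_neg, neg_sub]

lemma norm_sub_one_le {E : Type*} [NormedAddCommGroup E] [NormedSpace ℂ E] (W : E →L[ℂ] E)
    (h : ∀ f, ‖W f‖ = ‖f‖) : ‖W - 1‖ ≤ 2 := by
  refine opNorm_le_bound _ (by norm_num) fun f => ?_
  have h0 : (W - 1) f = W f - f := rfl
  rw [h0]
  refine (norm_sub_le _ _).trans ?_
  rw [h f]; linarith

lemma forwardU {U : EuclideanSpace ℝ (Fin n) → (Lp ℂ 2 μ →L[ℂ] Lp ℂ 2 μ)}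
    (hU : ∀ (x : EuclideanSpace ℝ (Fin n)) (f : Lp ℂ 2 μ),
      (U x f : EuclideanSpace ℝ (Fin n) → ℂ) =ᵐ[μ] fun y => f (x + y))
    (T : Lp ℂ 2 μ →L[ℂ] Lp ℂ 2 μ) (hT : IsCompactOperator T) :
    Tendsto (fun x : EuclideanSpace ℝ (Fin n) => ‖(U x - 1) ∘L T‖) (𝓝 0) (𝓝 0) := by
  have hUeq : ∀ x f, U x f = DomAddAct.mk x +ᵥ f := by
    intro x f
    apply Lp.ext
    exact (hU x f).trans (DomAddAct.vadd_Lp_ae_eq (DomAddAct.mk x) f).symm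
  have : Fact ((2 : ℝ≥0∞) ≠ ∞) := ⟨by norm_num⟩
  refine tendsto_of_compact _ 2 (fun x => norm_sub_one_le _ fun f => ?_) (fun g => ?_) T hT
  · rw [hUeq, DomAddAct.norm_vadd_Lp]
  · have h1 : Continuous fun x : EuclideanSpace ℝ (Fin n) => DomAddAct.mk x +ᵥ g :=
      DomAddAct.continuous_mk.vadd continuous_const
    have h2 : (fun x => (U x - 1) g) = fun x => (DomAddAct.mk x +ᵥ g) - g := by
      funext x
      rw [← hUeq]; rfl
    rw [h2]
    have h3 := (h1.sub (continuous_const (y := g))).tendsto 0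
    have h4 : DomAddAct.mk (0 : EuclideanSpace ℝ (Fin n)) +ᵥ g = g := by
      rw [DomAddAct.mk_zero, zero_vadd]
    simpa [h4, Pi.sub_def] using h3

lemma forwardV {V : EuclideanSpace ℝ (Fin n) → (Lp ℂ 2 μ →L[ℂ] Lp ℂ 2 μ)}
    (hV : ∀ (k : EuclideanSpace ℝ (Fin n)) (f : Lp ℂ 2 μ),
      (V k f : EuclideanSpace ℝ (Fin n) → ℂ) =ᵐ[μ]
        fun y => Complex.exp (Complex.I * (⟪y, k⟫ : ℝ)) * f y)
    (T : Lp ℂ 2 μ →L[ℂ] Lp ℂ 2 μ) (hT : IsCompactOperator T) :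
    Tendsto (fun x : EuclideanSpace ℝ (Fin n) => ‖(V x - 1) ∘L T‖) (𝓝 0) (𝓝 0) := by
  have hexp : ∀ θ : ℝ, ‖Complex.exp (Complex.I * θ)‖ = 1 := fun θ => by
    rw [mul_comm]; exact Complex.norm_exp_ofReal_mul_I θ
  refine tendsto_of_compact _ 2 (fun x => norm_sub_one_le _ fun f => ?_) (fun g => ?_) T hT
  · have h1 : ∀ᵐ y ∂μ, ‖V x f y‖ = ‖f y‖ := by
      filter_upwards [hV x f] with y hy
      rw [hy, norm_mul, hexp, one_mul]
    exact le_antisymm (Lp.norm_le_norm_of_ae_le (h1.mono fun _ h => h.le))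
      (Lp.norm_le_norm_of_ae_le (h1.mono fun _ h => h.ge))
  · have hg := (Lp.stronglyMeasurable g).measurable
    have h1 : Tendsto (fun k => ‖(V k - 1) g‖ₑ ^ 2) (𝓝 0) (𝓝 0) := by
      simp_rw [diffV hV]
      have h0 : (0 : ℝ≥0∞) = ∫⁻ y : EuclideanSpace ℝ (Fin n), 0 ∂μ := by simp
      suffices hs : Tendsto (fun k : EuclideanSpace ℝ (Fin n) => ∫⁻ y, ‖(Complex.exp (Complex.I * (⟪y, k⟫ : ℝ)) - 1) * g y‖ₑ ^ 2 ∂μ)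
          (𝓝 0) (𝓝 (∫⁻ y : EuclideanSpace ℝ (Fin n), 0 ∂μ)) by rwa [← h0] at hs
      refine tendsto_lintegral_filter_of_dominated_convergence
        (fun y => (2 * ‖g y‖ₑ) ^ 2) ?_ ?_ ?_ ?_
      · exact Eventually.of_forall fun k => by fun_prop
      · refine Eventually.of_forall fun k => Eventually.of_forall fun y => ?_
        simp only [enorm_mul]
        gcongr
        refine (enorm_sub_le).trans ?_
        rw [← ofReal_norm, hexp]
        norm_num
      · simp_rw [mul_pow]
        rw [lintegral_const_mul _ (by fun_prop), ← enorm_sq]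
        finiteness
      · refine Eventually.of_forall fun y => ?_
        have hc : Continuous fun k : EuclideanSpace ℝ (Fin n) =>
            ‖(Complex.exp (Complex.I * (⟪y, k⟫ : ℝ)) - 1) * g y‖ₑ ^ 2 := by fun_prop
        simpa using hc.tendsto 0
    have h2 : Tendsto (fun k => ‖(V k - 1) g‖ ^ 2) (𝓝 0) (𝓝 0) := by
      have := (ENNReal.tendsto_toReal (by simp)).comp h1
      simpa [Function.comp_def] using this
    rw [tendsto_zero_iff_norm_tendsto_zero]
    have := h2.sqrt
    simpa using this

lemma approx {U V : EuclideanSpace ℝ (Fin n) → (Lp ℂ 2 μ →L[ℂ] Lp ℂ 2 μ)}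
    (hU : ∀ (x : EuclideanSpace ℝ (Fin n)) (f : Lp ℂ 2 μ),
      (U x f : EuclideanSpace ℝ (Fin n) → ℂ) =ᵐ[μ] fun y => f (x + y))
    (hV : ∀ (k : EuclideanSpace ℝ (Fin n)) (f : Lp ℂ 2 μ),
      (V k f : EuclideanSpace ℝ (Fin n) → ℂ) =ᵐ[μ]
        fun y => Complex.exp (Complex.I * (⟪y, k⟫ : ℝ)) * f y)
    (T : Lp ℂ 2 μ →L[ℂ] Lp ℂ 2 μ)
    (h1 : Tendsto (fun k : EuclideanSpace ℝ (Fin n) => ‖(V k - 1) ∘L T‖) (𝓝 0) (𝓝 0))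
    (h2 : Tendsto (fun x : EuclideanSpace ℝ (Fin n) => ‖(U x - 1) ∘L T‖) (𝓝 0) (𝓝 0))
    (ε : ℝ) (hε : 0 < ε) :
    ∃ S : Lp ℂ 2 μ →L[ℂ] Lp ℂ 2 μ, IsCompactOperator S ∧ ‖T - S‖ ≤ ε := by
  obtain ⟨η, hη, hηε⟩ : ∃ η : ℝ, 0 < η ∧ (n + 1) * η ^ 2 ≤ ε ^ 2 := by
    refine ⟨ε / (n + 1), by positivity, ?_⟩
    have hn : (1 : ℝ) ≤ n + 1 := by simp
    have : (n + 1) * (ε / (n + 1)) ^ 2 = ε ^ 2 / (n + 1) := by field_simp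
    rw [this]
    exact div_le_self (by positivity) hn
  obtain ⟨δ₁, hδ₁, hV1⟩ := Metric.tendsto_nhds_nhds.1 h1 η hη
  obtain ⟨r, hr, hU1⟩ := Metric.tendsto_nhds_nhds.1 h2 η hη
  simp only [dist_zero_right, norm_norm] at hV1 hU1
  obtain ⟨δ, hδ, hδδ⟩ : ∃ δ : ℝ, 0 < δ ∧ δ < δ₁ := ⟨δ₁ / 2, by positivity, by linarith⟩
  let e : Fin n → EuclideanSpace ℝ (Fin n) := fun j => EuclideanSpace.single j 1
  let A : Fin n → Set (EuclideanSpace ℝ (Fin n)) := fun j => {y | 2 / δ ≤ |⟪y, e j⟫|}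
  have hAm : ∀ j, MeasurableSet (A j) := fun j => measurableSet_le (by fun_prop) (by fun_prop)
  let Bx : Set (EuclideanSpace ℝ (Fin n)) := (⋃ j, A j)ᶜ
  have hBm : MeasurableSet Bx := (MeasurableSet.iUnion hAm).compl
  have hBt : μ Bx < ∞ := by
    refine (measure_mono ?_).trans_lt (measure_closedBall_lt_top (μ := μ)
      (x := (0 : EuclideanSpace ℝ (Fin n))) (r := √(n * (2 / δ) ^ 2)))
    intro y hy
    simp only [Bx, A, e, Set.mem_compl_iff, Set.mem_iUnion, Set.mem_setOf_eq, not_exists, not_le] at hy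
    rw [mem_closedBall_zero_iff, EuclideanSpace.norm_eq]
    apply Real.sqrt_le_sqrt
    calc ∑ i, ‖y i‖ ^ 2 ≤ ∑ i : Fin n, (2 / δ) ^ 2 := by
          refine Finset.sum_le_sum fun i _ => ?_
          have := hy i
          rw [real_inner_comm, EuclideanSpace.inner_single_left] at this
          simp only [map_one, one_mul] at this
          rw [Real.norm_eq_abs]
          gcongr
      _ = n * (2 / δ) ^ 2 := by simp
  obtain ⟨C, hC⟩ := Psi_norm (μ := μ) r
  have hmem : MemLp (Bx.indicator (Psi μ r)) 2 μ := by
    refine (memLp_indicator_iff_restrict (f := Psi μ r) hBm).2 ?_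
    have : IsFiniteMeasure (μ.restrict Bx) := ⟨by simpa using hBt⟩
    exact MemLp.of_bound (Psi_cont r).aestronglyMeasurable C (Eventually.of_forall hC)
  refine ⟨K (hmem.toLp _) ∘L T, (K_compact (hmem.toLp _)).comp_clm T, ?_⟩
  refine opNorm_le_bound _ hε.le fun v => ?_
  set f := T v with hf
  set M : ℝ≥0∞ := (ENNReal.ofReal η * ‖v‖ₑ) ^ 2 with hM
  have hop : ∀ W : Lp ℂ 2 μ →L[ℂ] Lp ℂ 2 μ, ‖W ∘L T‖ < η → ‖W f‖ₑ ^ 2 ≤ M := by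
    intro W hW
    rw [hM]
    gcongr
    rw [← ofReal_norm, ← ofReal_norm, ← ENNReal.ofReal_mul hη.le]
    apply ENNReal.ofReal_le_ofReal
    exact ((W ∘L T).le_opNorm v).trans (by gcongr)
  have htail : ∀ j, ∫⁻ y in A j, ‖f y‖ₑ ^ 2 ∂μ ≤ M := by
    intro j
    refine tail f (e j) δ hδ M fun t ht => ?_
    rw [← diffV hV]
    apply hop
    apply hV1
    simp only [e, norm_smul, EuclideanSpace.norm_single, norm_one, mul_one, Real.norm_eq_abs, abs_of_pos ht.1]
    exact ht.2.trans_lt hδδ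
  have havg := average f r hr M fun x hx => by
    rw [← diffU hU]
    apply hop
    apply hU1
    simpa using hx
  simp_rw [← Psi_apply] at havg
  have hfm := (Lp.stronglyMeasurable f).measurable
  have hmain : ‖f - K (hmem.toLp _) f‖ₑ ^ 2 ≤ (n + 1) * M := by
    rw [enorm_sq]
    calc ∫⁻ y, ‖(f - K (hmem.toLp _) f : Lp ℂ 2 μ) y‖ₑ ^ 2 ∂μ
        ≤ ∫⁻ y, ((∑ j, (A j).indicator (fun y => ‖f y‖ₑ ^ 2) y) + ‖f y - Psi μ r y f‖ₑ ^ 2) ∂μ := by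
          apply lintegral_mono_ae
          filter_upwards [Lp.coeFn_sub f (K (hmem.toLp _) f), K_apply (hmem.toLp _) f,
            hmem.coeFn_toLp] with y e1 e2 e3
          rw [e1, Pi.sub_apply, e2, e3]
          by_cases hy : y ∈ Bx
          · rw [Set.indicator_of_mem hy]
            exact le_add_self
          · rw [Set.indicator_of_notMem hy]
            simp only [Bx, Set.mem_compl_iff, not_not, Set.mem_iUnion] at hy
            obtain ⟨j, hj⟩ := hy
            refine le_trans ?_ le_self_add
            refine le_trans ?_ (Finset.single_le_sum
              (f := fun j => (A j).indicator (fun y => ‖f y‖ₑ ^ 2) y)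
              (fun _ _ => zero_le) (Finset.mem_univ j))
            simp [Set.indicator_of_mem hj]
      _ = (∑ j, ∫⁻ y in A j, ‖f y‖ₑ ^ 2 ∂μ) + ∫⁻ y, ‖f y - Psi μ r y f‖ₑ ^ 2 ∂μ := by
          have hi : ∀ j, Measurable ((A j).indicator (fun y => ‖f y‖ₑ ^ 2)) := fun j =>
            Measurable.indicator (by fun_prop) (hAm j)
          rw [lintegral_add_left (Finset.measurable_fun_sum _ fun j _ => hi j),
            lintegral_finsetSum _ fun j _ => hi j]
          simp_rw [lintegral_indicator (hAm _)]
      _ ≤ (∑ j : Fin n, M) + M := by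
          gcongr with j _
          exact htail j
      _ = (n + 1) * M := by simp [add_mul]
  have hfin : ‖f - K (hmem.toLp _) f‖ ^ 2 ≤ (ε * ‖v‖) ^ 2 := by
    have h3 : (n + 1) * M = ENNReal.ofReal ((n + 1) * (η * ‖v‖) ^ 2) := by
      rw [ENNReal.ofReal_mul (by positivity), ENNReal.ofReal_pow (by positivity),
        ENNReal.ofReal_mul hη.le, ofReal_norm, hM, ENNReal.ofReal_add (by positivity) (by positivity)]
      simp
    rw [h3, ← ofReal_norm, ← ENNReal.ofReal_pow (norm_nonneg _),
      ENNReal.ofReal_le_ofReal_iff (by positivity)] at hmain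
    refine hmain.trans ?_
    rw [mul_pow, mul_pow, ← mul_assoc]
    gcongr
  exact (pow_le_pow_iff_left₀ (norm_nonneg _) (by positivity) (by norm_num)).1 hfin

end RK

/-- Riesz–Kolmogorov criterion in operator form: a bounded operator `T` on `L²(ℝⁿ)`
is compact iff `‖(V_k − 1)T‖ → 0` as `k → 0` and `‖(U_x − 1)T‖ → 0` as `x → 0`,
where `U_x` is translation and `V_k` multiplication by `e^{i⟨·,k⟩}`. -/
theorem stmt_19 {n : ℕ}
    (μ : Measure (EuclideanSpace ℝ (Fin n))) [μ.IsAddHaarMeasure]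
    (U V : EuclideanSpace ℝ (Fin n) → (Lp ℂ 2 μ →L[ℂ] Lp ℂ 2 μ))
    (hU : ∀ (x : EuclideanSpace ℝ (Fin n)) (f : Lp ℂ 2 μ),
      (U x f : EuclideanSpace ℝ (Fin n) → ℂ) =ᵐ[μ] fun y => f (x + y))
    (hV : ∀ (k : EuclideanSpace ℝ (Fin n)) (f : Lp ℂ 2 μ),
      (V k f : EuclideanSpace ℝ (Fin n) → ℂ) =ᵐ[μ]
        fun y => Complex.exp (Complex.I * (⟪y, k⟫ : ℝ)) * f y)
    (T : Lp ℂ 2 μ →L[ℂ] Lp ℂ 2 μ) :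
    IsCompactOperator T ↔
      (Tendsto (fun k : EuclideanSpace ℝ (Fin n) => ‖(V k - 1) ∘L T‖) (𝓝 0) (𝓝 0) ∧
       Tendsto (fun x : EuclideanSpace ℝ (Fin n) => ‖(U x - 1) ∘L T‖) (𝓝 0) (𝓝 0)) := by
  constructor
  · intro hT
    exact ⟨RK.forwardV hV T hT, RK.forwardU hU T hT⟩
  · rintro ⟨h1, h2⟩
    have hcl : IsClosed {S : Lp ℂ 2 μ →L[ℂ] Lp ℂ 2 μ | IsCompactOperator S} :=
      isClosed_setOfPred_isCompactOperator
    refine hcl.closure_subset (Metric.mem_closure_iff.2 fun ε hε => ?_)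
    obtain ⟨S, hS, hTS⟩ := RK.approx hU hV T h1 h2 (ε / 2) (by positivity)
    refine ⟨S, hS, ?_⟩
    rw [dist_eq_norm]
    linarith
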